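/- Let a : [-1,1] → [0,∞) be continuous, even (a(-x) = a(x) for all x ∈ [-1,1]) and satisfy condition (C), and suppose a(x₀) = 0 for some x₀ ∈ [-1,1). Then either a(x) = 0 for all x ∈ [-1,1], or there exists a positive integer m such that, with Δ := (1 - x₀)/m, a(x + Δ) = a(x) for every x ∈ [-1, 1-Δ] (i.e. a is periodic on [-1,1] with period dividing 1 - x₀). -/

import Mathlib

open MeasureTheory Set Filter
open scoped ENNReal BigOperators NNReal

noncomputable section

/-- `u ∈ W¹₁(-1,1)`: `u` is absolutely continuous on `[-1,1]` with (a.e.) derivative in `L¹`,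
encoded via the fundamental theorem of calculus with the pointwise derivative `deriv u`. -/
def MemW11 (u : ℝ → ℝ) : Prop :=
  IntegrableOn (deriv u) (Icc (-1 : ℝ) 1) volume ∧
  ∀ x ∈ Icc (-1 : ℝ) 1, u x = u (-1) + ∫ t in (-1 : ℝ)..x, deriv u t

/-- Convergence `u_k → u` in `W¹₁(-1,1)`. -/
def W11Tendsto (uk : ℕ → ℝ → ℝ) (u : ℝ → ℝ) : Prop :=
  Tendsto (fun k => ∫ x in Icc (-1 : ℝ) 1, (|uk k x - u x| + |deriv (uk k) x - deriv u x|))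
    atTop (nhds 0)

/-- `F ∈ 𝔉`: continuous, nonnegative, convex and nondecreasing in the second argument. -/
def MemFrakF (F : ℝ → ℝ → ℝ) : Prop :=
  ContinuousOn (fun p : ℝ × ℝ => F p.1 p.2) (Ici (0 : ℝ) ×ˢ Ici (0 : ℝ)) ∧
  (∀ v p : ℝ, 0 ≤ v → 0 ≤ p → 0 ≤ F v p) ∧
  (∀ v : ℝ, 0 ≤ v → ConvexOn ℝ (Ici (0 : ℝ)) (F v)) ∧
  (∀ v : ℝ, 0 ≤ v → MonotoneOn (F v) (Ici (0 : ℝ)))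

/-- A continuous nonnegative weight on `[-1,1] × [0,∞)`. -/
def Weight (a : ℝ → ℝ → ℝ) : Prop :=
  ContinuousOn (fun p : ℝ × ℝ => a p.1 p.2) (Icc (-1 : ℝ) 1 ×ˢ Ici (0 : ℝ)) ∧
  ∀ x v : ℝ, x ∈ Icc (-1 : ℝ) 1 → 0 ≤ v → 0 ≤ a x v

/-- Condition (C): `a(s,v) + a(t,v) ≥ a(1 - t + s, v)` for `-1 ≤ s ≤ t ≤ 1`, `v ≥ 0`. -/
def CondC (a : ℝ → ℝ → ℝ) : Prop :=
  ∀ s t v : ℝ, -1 ≤ s → s ≤ t → t ≤ 1 → 0 ≤ v → a (1 - t + s) v ≤ a s v + a t v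

/-- Condition (C) for a one-variable weight. -/
def CondC1 (a : ℝ → ℝ) : Prop :=
  ∀ s t : ℝ, -1 ≤ s → s ≤ t → t ≤ 1 → a (1 - t + s) ≤ a s + a t

/-- Condition (C'): `a(s,v) + a(t,v) ≥ a((s-t)/2, v) + a((t-s)/2, v)`. -/
def CondC' (a : ℝ → ℝ → ℝ) : Prop :=
  ∀ s t v : ℝ, s ∈ Icc (-1 : ℝ) 1 → t ∈ Icc (-1 : ℝ) 1 → 0 ≤ v →
    a ((s - t) / 2) v + a ((t - s) / 2) v ≤ a s v + a t v

/-- The functional `I(a,u) = ∫_{-1}^1 F(u(x), a(x,u(x))·|u'(x)|) dx ∈ [0,∞]`. -/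
def Ifun (F a : ℝ → ℝ → ℝ) (u : ℝ → ℝ) : ℝ≥0∞ :=
  ∫⁻ x in Icc (-1 : ℝ) 1, ENNReal.ofReal (F (u x) (a x (u x) * |deriv u x|))

/-- The monotone rearrangement `u*(x) = ∫₀^∞ χ_{[1-|A_t|,1]}(x) dt`,
where `A_t = {y ∈ [-1,1] : u(y) > t}`. -/
def mrear (u : ℝ → ℝ) (x : ℝ) : ℝ :=
  ∫ t in Ioi (0 : ℝ),
    (Icc (1 - (volume {y ∈ Icc (-1 : ℝ) 1 | u y > t}).toReal) 1).indicator
      (fun _ => (1 : ℝ)) x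

/-- The symmetric rearrangement `ū(x) = ∫₀^∞ χ_{[-|A_t|/2, |A_t|/2]}(x) dt`. -/
def srear (u : ℝ → ℝ) (x : ℝ) : ℝ :=
  ∫ t in Ioi (0 : ℝ),
    (Icc (-((volume {y ∈ Icc (-1 : ℝ) 1 | u y > t}).toReal / 2))
        ((volume {y ∈ Icc (-1 : ℝ) 1 | u y > t}).toReal / 2)).indicator
      (fun _ => (1 : ℝ)) x

/-- `u` is piecewise linear on `[-1,1]`: there is a partition `-1 = x₀ < ⋯ < x_n = 1`
such that `u` is affine on each `[x_i, x_{i+1}]`. -/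
def PiecewiseLinear (u : ℝ → ℝ) : Prop :=
  ∃ n : ℕ, ∃ x : Fin (n + 1) → ℝ, x 0 = -1 ∧ x (Fin.last n) = 1 ∧ StrictMono x ∧
    ∀ i : Fin n, ∃ c d : ℝ, ∀ y ∈ Icc (x i.castSucc) (x i.succ), u y = c * y + d

/-- an even weight satisfying condition (C) with a zero is identically zero or
periodic with period dividing `1 - x₀`. -/
theorem stmt5 (a : ℝ → ℝ) (hcont : ContinuousOn a (Icc (-1 : ℝ) 1))
    (heven : ∀ x ∈ Icc (-1 : ℝ) 1, a (-x) = a x)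
    (hnn : ∀ x ∈ Icc (-1 : ℝ) 1, 0 ≤ a x) (hC : CondC1 a)
    (x₀ : ℝ) (hx₀ : x₀ ∈ Ico (-1 : ℝ) 1) (hzero : a x₀ = 0) :
    (∀ x ∈ Icc (-1 : ℝ) 1, a x = 0) ∨
    ∃ m : ℕ, 0 < m ∧ ∀ x ∈ Icc (-1 : ℝ) (1 - (1 - x₀) / m),
      a (x + (1 - x₀) / m) = a x := by
  obtain ⟨h₁, h₂⟩ := hx₀
  refine Or.inr ⟨1, one_pos, fun x hx => ?_⟩
  simp only [Nat.cast_one, div_one, sub_sub_cancel, mem_Icc] at hx ⊢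
  obtain ⟨hx₁, hx₂⟩ := hx
  have hle : a (x + (1 - x₀)) ≤ a x := by
    have h := hC x x₀ hx₁ hx₂ h₂.le
    rwa [hzero, add_zero, show 1 - x₀ + x = x + (1 - x₀) by ring] at h
  have hge : a x ≤ a (x + (1 - x₀)) := by
    have h := hC (-x₀) (x + (1 - x₀)) (by linarith) (by linarith) (by linarith)
    rwa [heven x₀ ⟨h₁, h₂.le⟩, hzero, zero_add,
      show 1 - (x + (1 - x₀)) + -x₀ = -x by ring, heven x ⟨hx₁, by linarith⟩] at h
  exact le_antisymm hle hge
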